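/- Let 𝒜 = {(m,n) ∈ ℤ² : (m,n) ≡ (−1,−2), (2,1), (1,0), or (−2,3) (mod 6)} and ℬ = {(m,n) ∈ ℤ² : (m,n) ≡ (1,0), (−2,3), (1,−1), (−2,2), (2,−1), or (−1,2) (mod 6)}. Then Σ_{(m,n)∈𝒜} (m+3n)/(m²+3n²)² − (3/4) · Σ_{(m,n)∈ℬ} (m+3n)/(m²+3n²)² = (3/2) · Σ_{(m,n)∈ℤ², 3∤n} m·χ₋₃(m)/(3m²+n²)². -/

import Mathlib

/-- The quadratic character mod 3. -/
def chi3 (m : ℤ) : ℤ := if m % 3 = 1 then 1 else if m % 3 = 2 then -1 else 0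

/-- `𝒜 = {(m,n) ∈ ℤ² : (m,n) ≡ (−1,−2), (2,1), (1,0), (−2,3) (mod 6)}`. -/
def Aset : Set (ℤ × ℤ) := {p |
  (Int.ModEq 6 p.1 (-1) ∧ Int.ModEq 6 p.2 (-2)) ∨
  (Int.ModEq 6 p.1 2 ∧ Int.ModEq 6 p.2 1) ∨
  (Int.ModEq 6 p.1 1 ∧ Int.ModEq 6 p.2 0) ∨
  (Int.ModEq 6 p.1 (-2) ∧ Int.ModEq 6 p.2 3)}

/-- `ℬ = {(m,n) ∈ ℤ² : (m,n) ≡ (1,0), (−2,3), (1,−1), (−2,2), (2,−1), (−1,2) (mod 6)}`. -/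
def Bset : Set (ℤ × ℤ) := {p |
  (Int.ModEq 6 p.1 1 ∧ Int.ModEq 6 p.2 0) ∨
  (Int.ModEq 6 p.1 (-2) ∧ Int.ModEq 6 p.2 3) ∨
  (Int.ModEq 6 p.1 1 ∧ Int.ModEq 6 p.2 (-1)) ∨
  (Int.ModEq 6 p.1 (-2) ∧ Int.ModEq 6 p.2 2) ∨
  (Int.ModEq 6 p.1 2 ∧ Int.ModEq 6 p.2 (-1)) ∨
  (Int.ModEq 6 p.1 (-1) ∧ Int.ModEq 6 p.2 2)}

/-- summand -/
noncomputable def ff (a b : ℝ) (p : ℤ × ℤ) : ℝ :=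
  (a * (p.1 : ℝ) + b * (p.2 : ℝ)) / ((p.1 : ℝ) ^ 2 + 3 * (p.2 : ℝ) ^ 2) ^ 2

noncomputable def TT (S : Set (ℤ × ℤ)) (a b : ℝ) : ℝ := ∑' p : S, ff a b p.1

def Od (i j : ℤ) : Set (ℤ × ℤ) := {p | p.1 % 3 = i ∧ p.2 % 3 = j ∧ (p.1 + p.2) % 2 = 1}
def Ev (i j : ℤ) : Set (ℤ × ℤ) := {p | p.1 % 3 = i ∧ p.2 % 3 = j ∧ (p.1 + p.2) % 2 = 0}

lemma ff_summable (a b : ℝ) : Summable (ff a b) := by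
  have h := (EisensteinSeries.summable_one_div_norm_rpow (k := 3) (by norm_num)).mul_left (|a| + |b|)
  rw [← (finTwoArrowEquiv ℤ).symm.summable_iff] at h
  refine Summable.of_norm_bounded h ?_
  rintro ⟨m, n⟩
  simp only [Function.comp, finTwoArrowEquiv_symm_apply, ff]
  set x : Fin 2 → ℤ := ![m, n] with hx
  have hm : |(m : ℝ)| ≤ ‖x‖ := by
    have := norm_le_pi_norm x 0
    simpa [hx, Int.norm_eq_abs] using this
  have hn : |(n : ℝ)| ≤ ‖x‖ := by
    have := norm_le_pi_norm x 1
    simpa [hx, Int.norm_eq_abs] using this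
  have hN : ‖x‖ ^ 2 ≤ (m : ℝ) ^ 2 + 3 * (n : ℝ) ^ 2 := by
    have : ‖x‖ ≤ √((m : ℝ) ^ 2 + 3 * (n : ℝ) ^ 2) := by
      refine (pi_norm_le_iff_of_nonneg (Real.sqrt_nonneg _)).2 ?_
      intro i
      fin_cases i
      · simp only [hx, Int.norm_eq_abs]
        apply Real.abs_le_sqrt
        simp
        positivity
      · simp only [hx, Int.norm_eq_abs]
        apply Real.abs_le_sqrt
        simp
        nlinarith [sq_nonneg (m : ℝ), sq_nonneg (n : ℝ)]
    calc ‖x‖ ^ 2 ≤ (√((m : ℝ) ^ 2 + 3 * (n : ℝ) ^ 2)) ^ 2 := by gcongr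
      _ = _ := Real.sq_sqrt (by positivity)
  rcases (norm_nonneg x).eq_or_lt with h0 | h0
  · rw [← h0] at hm hn
    have h1 : (m : ℝ) = 0 := abs_nonpos_iff.1 hm
    have h2 : (n : ℝ) = 0 := abs_nonpos_iff.1 hn
    simp [h1, h2]
    positivity
  · have e : ‖x‖ ^ (-3 : ℝ) = 1 / ‖x‖ ^ 3 := by
      rw [Real.rpow_neg h0.le, one_div]
      norm_cast
    rw [e, norm_div, Real.norm_eq_abs, Real.norm_eq_abs, abs_of_nonneg (by positivity : (0 : ℝ) ≤ ((m : ℝ) ^ 2 + 3 * (n : ℝ) ^ 2) ^ 2)]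
    calc |a * (m : ℝ) + b * (n : ℝ)| / ((m : ℝ) ^ 2 + 3 * (n : ℝ) ^ 2) ^ 2
        ≤ ((|a| + |b|) * ‖x‖) / (‖x‖ ^ 2) ^ 2 := by
          gcongr
          calc |a * (m : ℝ) + b * (n : ℝ)| ≤ |a * (m : ℝ)| + |b * (n : ℝ)| := abs_add_le _ _
            _ = |a| * |(m : ℝ)| + |b| * |(n : ℝ)| := by rw [abs_mul, abs_mul]
            _ ≤ |a| * ‖x‖ + |b| * ‖x‖ := by gcongr
            _ = _ := by ring
      _ = _ := by field_simp

lemma TT_lin (S : Set (ℤ × ℤ)) (a b : ℝ) : TT S a b = a * TT S 1 0 + b * TT S 0 1 := by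
  unfold TT
  rw [← tsum_mul_left, ← tsum_mul_left, ← Summable.tsum_add]
  · refine tsum_congr fun p => ?_
    simp only [ff]
    ring
  · exact ((ff_summable 1 0).subtype S).mul_left a
  · exact ((ff_summable 0 1).subtype S).mul_left b

lemma TT_union (S T U : Set (ℤ × ℤ)) (a b : ℝ) (h : ∀ p, p ∈ U ↔ p ∈ S ∨ p ∈ T)
    (hd : ∀ p, p ∈ S → p ∈ T → False) : TT U a b = TT S a b + TT T a b := by
  have : U = S ∪ T := by ext p; simpa using h p
  subst this
  exact Summable.tsum_union_disjoint (Set.disjoint_left.2 fun p h1 h2 => hd p h1 h2)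
    ((ff_summable a b).subtype S) ((ff_summable a b).subtype T)

lemma TT_tr (S T : Set (ℤ × ℤ)) (a b a' b' : ℝ) (φ ψ : ℤ × ℤ → ℤ × ℤ)
    (h : ∀ m n, (m, n) ∈ S → φ (m, n) ∈ T ∧ ψ (φ (m, n)) = (m, n))
    (h' : ∀ m n, (m, n) ∈ T → ψ (m, n) ∈ S ∧ φ (ψ (m, n)) = (m, n))
    (hf : ∀ m n, (m, n) ∈ T → ff a b (ψ (m, n)) = ff a' b' (m, n)) :
    TT S a b = TT T a' b' := by
  let e : T ≃ S :=
    { toFun := fun p => ⟨ψ p.1, (h' _ _ p.2).1⟩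
      invFun := fun p => ⟨φ p.1, (h _ _ p.2).1⟩
      left_inv := fun p => Subtype.ext (h' _ _ p.2).2
      right_inv := fun p => Subtype.ext (h _ _ p.2).2 }
  unfold TT
  rw [← e.tsum_eq]
  exact tsum_congr fun p => hf _ _ p.2

lemma TT_neg (S T : Set (ℤ × ℤ)) (a b : ℝ) (h : ∀ m n, (m, n) ∈ S ↔ (-m, -n) ∈ T) :
    TT S a b = TT T (-a) (-b) := by
  refine TT_tr S T a b _ _ (fun p => (-p.1, -p.2)) (fun p => (-p.1, -p.2)) ?_ ?_ ?_
  · intro m n hm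
    exact ⟨(h m n).1 hm, by simp⟩
  · intro m n hm
    exact ⟨(h _ _).2 (by simpa using hm), by simp⟩
  · intro m n _
    simp [ff]

lemma TT_conj (S T : Set (ℤ × ℤ)) (a b : ℝ) (h : ∀ m n, (m, n) ∈ S ↔ (m, -n) ∈ T) :
    TT S a b = TT T a (-b) := by
  refine TT_tr S T a b _ _ (fun p => (p.1, -p.2)) (fun p => (p.1, -p.2)) ?_ ?_ ?_
  · intro m n hm
    exact ⟨(h m n).1 hm, by simp⟩
  · intro m n hm
    exact ⟨(h _ _).2 (by simpa using hm), by simp⟩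
  · intro m n _
    simp [ff]

lemma A_eq : TT Aset 1 3 = TT (Od 1 0) 1 3 + TT (Od 2 1) 1 3 := by
  apply TT_union
  · rintro ⟨m, n⟩
    simp only [Aset, Od, Set.mem_ofPred_eq, Int.ModEq]
    omega
  · rintro ⟨m, n⟩
    simp only [Od, Set.mem_ofPred_eq]
    omega

lemma B_eq : TT Bset 1 3 = (TT (Od 1 0) 1 3 + TT (Od 2 2) 1 3) + TT (Ev 1 2) 1 3 := by
  rw [← TT_union (Od 1 0) (Od 2 2) (Od 1 0 ∪ Od 2 2) 1 3 (fun p => Iff.rfl)]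
  · apply TT_union
    · rintro ⟨m, n⟩
      simp only [Bset, Od, Ev, Set.mem_union, Set.mem_ofPred_eq, Int.ModEq]
      omega
    · rintro ⟨m, n⟩
      simp only [Od, Ev, Set.mem_union, Set.mem_ofPred_eq]
      omega
  · rintro ⟨m, n⟩
    simp only [Od, Set.mem_ofPred_eq]
    omega

/-- halves -/
def E0 : Set (ℤ × ℤ) := {p | p.1 % 3 = 1 ∧ p.2 % 3 = 2 ∧ p.1 % 2 = 0 ∧ p.2 % 2 = 0}
def E1 : Set (ℤ × ℤ) := {p | p.1 % 3 = 1 ∧ p.2 % 3 = 2 ∧ p.1 % 2 = 1 ∧ (p.1 - p.2) % 4 = 0}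
def E2 : Set (ℤ × ℤ) := {p | p.1 % 3 = 1 ∧ p.2 % 3 = 2 ∧ p.1 % 2 = 1 ∧ (p.1 + p.2) % 4 = 0}

lemma Ev_split : TT (Ev 1 2) 1 3 = (TT E0 1 3 + TT E1 1 3) + TT E2 1 3 := by
  rw [← TT_union E0 E1 (E0 ∪ E1) 1 3 (fun p => Iff.rfl)]
  · apply TT_union
    · rintro ⟨m, n⟩
      simp only [E0, E1, E2, Ev, Set.mem_union, Set.mem_ofPred_eq]
      omega
    · rintro ⟨m, n⟩
      simp only [E0, E1, E2, Set.mem_union, Set.mem_ofPred_eq]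
      omega
  · rintro ⟨m, n⟩
    simp only [E0, E1, Set.mem_ofPred_eq]
    omega

lemma E0_eq : TT E0 1 3 = TT (Od 2 1) (1/8) (3/8) + TT (Ev 2 1) (1/8) (3/8) := by
  rw [← TT_union (Od 2 1) (Ev 2 1) (Od 2 1 ∪ Ev 2 1) (1/8) (3/8) (fun p => Iff.rfl)]
  · refine TT_tr _ _ _ _ _ _ (fun p => (p.1 / 2, p.2 / 2)) (fun p => (2 * p.1, 2 * p.2)) ?_ ?_ ?_
    · intro m n
      simp only [E0, Od, Ev, Set.mem_union, Set.mem_ofPred_eq, Prod.mk.injEq]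
      omega
    · intro m n
      simp only [E0, Od, Ev, Set.mem_union, Set.mem_ofPred_eq, Prod.mk.injEq]
      omega
    · intro m n _
      simp only [ff]
      push_cast
      rw [show (((2 : ℝ) * m) ^ 2 + 3 * (2 * n) ^ 2) ^ 2 = 16 * ((m : ℝ) ^ 2 + 3 * n ^ 2) ^ 2 by ring,
        ← div_div]
      ring
  · rintro ⟨m, n⟩
    simp only [Od, Ev, Set.mem_ofPred_eq]
    omega

lemma E1_eq : TT E1 1 3 = TT (Od 2 2) (-1/4) 0 := by
  refine TT_tr _ _ _ _ _ _ (fun p => ((-p.1 - 3 * p.2) / 4, (p.1 - p.2) / 4))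
    (fun p => (-p.1 + 3 * p.2, -p.1 - p.2)) ?_ ?_ ?_
  · intro m n
    simp only [E1, Od, Set.mem_ofPred_eq, Prod.mk.injEq]
    omega
  · intro m n
    simp only [E1, Od, Set.mem_ofPred_eq, Prod.mk.injEq]
    omega
  · intro m n _
    simp only [ff]
    push_cast
    rw [show ((-(m : ℝ) + 3 * n) ^ 2 + 3 * (-m - n) ^ 2) ^ 2 = 16 * ((m : ℝ) ^ 2 + 3 * n ^ 2) ^ 2 by ring,
      ← div_div]
    ring

lemma E2_eq : TT E2 1 3 = TT (Od 2 0) (1/8) (-3/8) := by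
  refine TT_tr _ _ _ _ _ _ (fun p => ((-p.1 + 3 * p.2) / 4, (-p.1 - p.2) / 4))
    (fun p => (-p.1 - 3 * p.2, p.1 - p.2)) ?_ ?_ ?_
  · intro m n
    simp only [E2, Od, Set.mem_ofPred_eq, Prod.mk.injEq]
    omega
  · intro m n
    simp only [E2, Od, Set.mem_ofPred_eq, Prod.mk.injEq]
    omega
  · intro m n _
    simp only [ff]
    push_cast
    rw [show ((-(m : ℝ) - 3 * n) ^ 2 + 3 * (m - n) ^ 2) ^ 2 = 16 * ((m : ℝ) ^ 2 + 3 * n ^ 2) ^ 2 by ring,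
      ← div_div]
    ring

lemma refl_eq : TT (Ev 2 1) 1 1 = TT (Ev 2 1) (-1) (-1) := by
  refine TT_tr _ _ _ _ _ _ (fun p => ((-p.1 - 3 * p.2) / 2, (-p.1 + p.2) / 2))
    (fun p => ((-p.1 - 3 * p.2) / 2, (-p.1 + p.2) / 2)) ?_ ?_ ?_
  · intro m n
    simp only [Ev, Set.mem_ofPred_eq, Prod.mk.injEq]
    omega
  · intro m n
    simp only [Ev, Set.mem_ofPred_eq, Prod.mk.injEq]
    omega
  · intro m n h
    simp only [Ev, Set.mem_ofPred_eq] at h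
    obtain ⟨u, hu⟩ : ∃ u, (-m - 3 * n) / 2 = u := ⟨_, rfl⟩
    obtain ⟨v, hv⟩ : ∃ v, (-m + n) / 2 = v := ⟨_, rfl⟩
    have h1 : m = (-u - 3 * v) / 2 := by omega
    have hn : n = u + 0 - (-1) * n - n - u + n := by ring
    have h2 : 2 * u = -m - 3 * n := by omega
    have h3 : 2 * v = -m + n := by omega
    have h2' : (u : ℝ) = (-m - 3 * n) / 2 := by
      have : (2 : ℝ) * u = -m - 3 * n := by exact_mod_cast h2
      linarith
    have h3' : (v : ℝ) = (-m + n) / 2 := by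
      have : (2 : ℝ) * v = -m + n := by exact_mod_cast h3
      linarith
    simp only [ff, hu, hv, h2', h3']
    congr 1 <;> ring

noncomputable def kk : ℤ × ℤ → ℝ := fun p =>
  (Od 2 1 ∪ Ev 2 1).indicator (ff 0 1) (p.2, p.1)

lemma kk_summable : Summable kk :=
  (Equiv.prodComm ℤ ℤ).summable_iff.2 ((ff_summable 0 1).indicator _)

lemma kk_tsum : ∑' p, kk p = TT (Od 2 1) 0 1 + TT (Ev 2 1) 0 1 := by
  rw [← TT_union (Od 2 1) (Ev 2 1) (Od 2 1 ∪ Ev 2 1) _ _ (fun p => Iff.rfl)]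
  · unfold TT
    rw [tsum_subtype]
    exact (Equiv.prodComm ℤ ℤ).tsum_eq ((Od 2 1 ∪ Ev 2 1).indicator (ff 0 1))
  · rintro ⟨m, n⟩
    simp only [Od, Ev, Set.mem_ofPred_eq]
    omega

lemma kk_apply (m n : ℤ) : kk (m, n) = if m % 3 = 1 ∧ n % 3 = 2 then
    (m : ℝ) / (3 * (m : ℝ) ^ 2 + (n : ℝ) ^ 2) ^ 2 else 0 := by
  classical
  unfold kk
  rw [Set.indicator_apply]
  have : ((n, m) ∈ Od 2 1 ∪ Ev 2 1) ↔ (m % 3 = 1 ∧ n % 3 = 2) := by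
    simp only [Od, Ev, Set.mem_union, Set.mem_ofPred_eq]
    omega
  simp only [this]
  congr 1
  simp only [ff]
  congr 1 <;> ring

lemma kk_four (m n : ℤ) : (if ¬ (3 ∣ n) then ((m : ℝ) * (chi3 m : ℝ)) /
      (3 * (m : ℝ) ^ 2 + (n : ℝ) ^ 2) ^ 2 else 0) =
    kk (m, n) + kk (-m, n) + (kk (m, -n) + kk (-m, -n)) := by
  simp only [kk_apply, chi3]
  have hm : m % 3 = 0 ∨ m % 3 = 1 ∨ m % 3 = 2 := by omega
  have hn : n % 3 = 0 ∨ n % 3 = 1 ∨ n % 3 = 2 := by omega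
  have hm0 : (-m) % 3 = if m % 3 = 0 then 0 else if m % 3 = 1 then 2 else 1 := by
    split_ifs <;> omega
  have hn0 : (-n) % 3 = if n % 3 = 0 then 0 else if n % 3 = 1 then 2 else 1 := by
    split_ifs <;> omega
  rw [hm0, hn0]
  have hd : (3 ∣ n) ↔ n % 3 = 0 := by omega
  simp only [hd]
  rcases hm with h | h | h <;> rcases hn with h' | h' | h' <;> simp [h, h']


lemma kk_equiv (e : ℤ × ℤ ≃ ℤ × ℤ) (g : ℤ × ℤ → ℝ) (h : ∀ p, g p = kk (e p)) :
    Summable g ∧ ∑' p, g p = ∑' p, kk p := by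
  have : g = kk ∘ e := funext h
  rw [this]
  exact ⟨e.summable_iff.2 kk_summable, e.tsum_eq kk⟩

lemma C_eq : ∑' p : {p : ℤ × ℤ // ¬ (3 ∣ p.2)},
        ((p.1.1 : ℝ) * (chi3 p.1.1 : ℝ)) /
          (3 * (p.1.1 : ℝ) ^ 2 + (p.1.2 : ℝ) ^ 2) ^ 2 =
    4 * (TT (Od 2 1) 0 1 + TT (Ev 2 1) 0 1) := by
  have s0 := kk_summable
  obtain ⟨s1, t1⟩ := kk_equiv ((Equiv.neg ℤ).prodCongr (Equiv.refl ℤ))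
    (fun p => kk (-p.1, p.2)) (fun p => rfl)
  obtain ⟨s2, t2⟩ := kk_equiv ((Equiv.refl ℤ).prodCongr (Equiv.neg ℤ))
    (fun p => kk (p.1, -p.2)) (fun p => rfl)
  obtain ⟨s3, t3⟩ := kk_equiv ((Equiv.neg ℤ).prodCongr (Equiv.neg ℤ))
    (fun p => kk (-p.1, -p.2)) (fun p => rfl)
  have key : ∑' p, (kk p + kk (-p.1, p.2) + (kk (p.1, -p.2) + kk (-p.1, -p.2))) =
      4 * (TT (Od 2 1) 0 1 + TT (Ev 2 1) 0 1) := by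
    rw [(s0.add s1).tsum_add (s2.add s3), s0.tsum_add s1, s2.tsum_add s3,
      t1, t2, t3, kk_tsum]
    ring
  rw [← key]
  have h0 := Subtype.val_injective (p := fun p : ℤ × ℤ => ¬ (3 ∣ p.2)) |>.tsum_eq
    (f := fun p : ℤ × ℤ => kk p + kk (-p.1, p.2) + (kk (p.1, -p.2) + kk (-p.1, -p.2))) (by
      rintro ⟨m, n⟩ h
      simp only [Subtype.range_coe_subtype, Set.mem_ofPred_eq]
      intro hn
      apply h
      have := kk_four m n
      rw [if_neg (not_not.2 hn)] at this
      exact this.symm)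
  rw [← h0]
  congr 1
  funext p
  obtain ⟨⟨m, n⟩, hn⟩ := p
  have := kk_four m n
  rw [if_pos hn] at this
  exact this

theorem stmt11 :
    (∑' p : Aset, ((p.1.1 : ℝ) + 3 * (p.1.2 : ℝ)) /
        ((p.1.1 : ℝ) ^ 2 + 3 * (p.1.2 : ℝ) ^ 2) ^ 2) -
      (3/4) * (∑' p : Bset, ((p.1.1 : ℝ) + 3 * (p.1.2 : ℝ)) /
        ((p.1.1 : ℝ) ^ 2 + 3 * (p.1.2 : ℝ) ^ 2) ^ 2) =
    (3/2) * ∑' p : {p : ℤ × ℤ // ¬ (3 ∣ p.2)},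
        ((p.1.1 : ℝ) * (chi3 p.1.1 : ℝ)) /
          (3 * (p.1.1 : ℝ) ^ 2 + (p.1.2 : ℝ) ^ 2) ^ 2 := by
  rw [C_eq]
  have hA : (∑' p : Aset, ((p.1.1 : ℝ) + 3 * (p.1.2 : ℝ)) /
        ((p.1.1 : ℝ) ^ 2 + 3 * (p.1.2 : ℝ) ^ 2) ^ 2) = TT Aset 1 3 := by
    simp [TT, ff]
  have hB : (∑' p : Bset, ((p.1.1 : ℝ) + 3 * (p.1.2 : ℝ)) /
        ((p.1.1 : ℝ) ^ 2 + 3 * (p.1.2 : ℝ) ^ 2) ^ 2) = TT Bset 1 3 := by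
    simp [TT, ff]
  rw [hA, hB, A_eq, B_eq]
  have h1 := Ev_split
  rw [E0_eq, E1_eq, E2_eq] at h1
  have h2 := refl_eq
  have h3 : TT (Ev 1 2) 1 3 = TT (Ev 2 1) (-1) (-3) := by
    apply TT_neg
    intro m n
    simp only [Ev, Set.mem_ofPred_eq]
    omega
  have h4 : TT (Od 2 1) 1 0 = TT (Od 2 2) 1 (-0) := by
    apply TT_conj
    intro m n
    simp only [Od, Set.mem_ofPred_eq]
    omega
  have h5 : TT (Od 2 1) 0 1 = TT (Od 2 2) 0 (-1) := by
    apply TT_conj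
    intro m n
    simp only [Od, Set.mem_ofPred_eq]
    omega
  have h6 : TT (Od 2 0) (1/8) (-3/8) = TT (Od 1 0) (-(1/8)) (-(-3/8)) := by
    apply TT_neg
    intro m n
    simp only [Od, Set.mem_ofPred_eq]
    omega
  have h7 : TT (Od 1 0) 0 1 = TT (Od 1 0) 0 (-1) := by
    apply TT_conj
    intro m n
    simp only [Od, Set.mem_ofPred_eq]
    omega
  rw [h6] at h1
  rw [TT_lin _ (-1) (-3), TT_lin _ 1 3] at h3
  rw [neg_zero] at h4
  rw [TT_lin _ 0 (-1)] at h5 h7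
  rw [TT_lin _ 1 1, TT_lin _ (-1) (-1)] at h2
  rw [TT_lin _ 1 3, TT_lin (Od 2 1) (1/8), TT_lin (Ev 2 1) (1/8), TT_lin (Od 2 2) (-1/4),
    TT_lin (Od 1 0) (-(1/8))] at h1
  rw [TT_lin (Od 1 0) 1 3, TT_lin (Od 2 1) 1 3, TT_lin (Od 2 2) 1 3, TT_lin (Ev 1 2) 1 3]
  linarith
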